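/- If (p, ≺) is a maximally delayed Pauli flow of a labelled open graph (G, I, O, λ), then V_0^≺ = O ∪ V_0^{≺,XY} ∪ V_0^{≺,XZ} ∪ V_0^{≺,YZ}. -/

import Mathlib

open scoped symmDiff

inductive MeasLabel : Type
  | XY | XZ | YZ | X | Y | Z
deriving DecidableEq

/-- A labelled open graph: a finite simple graph with input and output sets and a
measurement labelling (only its values on non-outputs are ever used). -/
structure LOG (V : Type) [Fintype V] where
  G : SimpleGraph V
  I : Set V
  O : Set V
  lam : V → MeasLabel

namespace LOG

variable {V : Type} [Fintype V]

/-- The odd neighbourhood of `A`: vertices with an odd number of neighbours in `A`. -/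
def odd (G : SimpleGraph V) (A : Set V) : Set V :=
  {w | Odd ((G.neighborSet w ∩ A).ncard)}

/-- `v` is a measured (non-output) vertex whose label lies in `s`.  (The labelling of a
labelled open graph is only defined on non-outputs.) -/
def labIn (Γ : LOG V) (v : V) (s : Set MeasLabel) : Prop :=
  v ∉ Γ.O ∧ Γ.lam v ∈ s

/-- The Pauli flow conditions for a map `p` and a strict partial order `prec` (`≺`). -/
structure IsPauliFlow (Γ : LOG V) (p : V → Set V) (prec : V → V → Prop) : Prop where
  irrefl : ∀ a, ¬ prec a a
  trans : ∀ a b c, prec a b → prec b c → prec a c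
  psub : ∀ u, u ∉ Γ.O → ∀ v ∈ p u, v ∉ Γ.I
  pf1 : ∀ u, u ∉ Γ.O → ∀ v ∈ p u, u ≠ v →
    ¬ Γ.labIn v {MeasLabel.X, MeasLabel.Y} → prec u v
  pf2 : ∀ u, u ∉ Γ.O → ∀ v ∈ odd Γ.G (p u), u ≠ v →
    ¬ Γ.labIn v {MeasLabel.Y, MeasLabel.Z} → prec u v
  pf3 : ∀ u, u ∉ Γ.O → ∀ v, ¬ prec u v → u ≠ v →
    Γ.labIn v {MeasLabel.Y} → (v ∈ p u ↔ v ∈ odd Γ.G (p u))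
  pf4 : ∀ u, u ∉ Γ.O → Γ.lam u = MeasLabel.XY → u ∉ p u ∧ u ∈ odd Γ.G (p u)
  pf5 : ∀ u, u ∉ Γ.O → Γ.lam u = MeasLabel.XZ → u ∈ p u ∧ u ∈ odd Γ.G (p u)
  pf6 : ∀ u, u ∉ Γ.O → Γ.lam u = MeasLabel.YZ → u ∈ p u ∧ u ∉ odd Γ.G (p u)
  pf7 : ∀ u, u ∉ Γ.O → Γ.lam u = MeasLabel.X → u ∈ odd Γ.G (p u)
  pf8 : ∀ u, u ∉ Γ.O → Γ.lam u = MeasLabel.Z → u ∈ p u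
  pf9 : ∀ u, u ∉ Γ.O → Γ.lam u = MeasLabel.Y →
    ((u ∈ p u ∧ u ∉ odd Γ.G (p u)) ∨ (u ∉ p u ∧ u ∈ odd Γ.G (p u)))

/-- `phat` is focussed over `S`. -/
def FocussedOver (Γ : LOG V) (phat S : Set V) : Prop :=
  (∀ w ∈ S ∩ phat, Γ.lam w ∈ ({MeasLabel.XY, MeasLabel.X, MeasLabel.Y} : Set MeasLabel)) ∧
  (∀ w ∈ S ∩ odd Γ.G phat,
    Γ.lam w ∈ ({MeasLabel.XZ, MeasLabel.YZ, MeasLabel.Y, MeasLabel.Z} : Set MeasLabel)) ∧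
  (∀ w ∈ S, Γ.lam w = MeasLabel.Y → (w ∈ phat ↔ w ∈ odd Γ.G phat))

/-- A focussed set for `Γ`: a subset of the non-inputs that is focussed over all
non-outputs. -/
def IsFocussedSet (Γ : LOG V) (phat : Set V) : Prop :=
  (∀ v ∈ phat, v ∉ Γ.I) ∧ FocussedOver Γ phat {v | v ∉ Γ.O}

/-- A Pauli flow map `p` is focussed if each `p v` is focussed over the measured
vertices other than `v`. -/
def IsFocussed (Γ : LOG V) (p : V → Set V) : Prop :=
  ∀ v, v ∉ Γ.O → FocussedOver Γ (p v) ({w | w ∉ Γ.O} \ {v})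

/-- `Vcum prec k` is `V_{∪k}^≺`, the union of the layers up to depth `k`. -/
def Vcum (prec : V → V → Prop) : ℕ → Set V
  | 0 => {v | ∀ w, ¬ prec v w}
  | k + 1 => Vcum prec k ∪ {v | v ∉ Vcum prec k ∧ ∀ w, w ∉ Vcum prec k → ¬ prec v w}

/-- `Vlayer prec k` is `V_k^≺`, the `≺`-maximal elements among the vertices not of
smaller depth. -/
def Vlayer (prec : V → V → Prop) : ℕ → Set V
  | 0 => {v | ∀ w, ¬ prec v w}
  | k + 1 => {v | v ∉ Vcum prec k ∧ ∀ w, w ∉ Vcum prec k → ¬ prec v w}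

/-- `prec` is more delayed than `prec'`. -/
def MoreDelayed (prec prec' : V → V → Prop) : Prop :=
  (∀ k, (Vcum prec' k).ncard ≤ (Vcum prec k).ncard) ∧
  ∃ k, (Vcum prec' k).ncard < (Vcum prec k).ncard

/-- A maximally delayed Pauli flow: no Pauli flow for the same labelled open graph is
more delayed. -/
def IsMaxDelayed (Γ : LOG V) (p : V → Set V) (prec : V → V → Prop) : Prop :=
  IsPauliFlow Γ p prec ∧
  ∀ q prec', IsPauliFlow Γ q prec' → ¬ MoreDelayed prec' prec

/-- `Λ_u^P`: the measured vertices other than `u` whose label is `P`. -/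
def LamP (Γ : LOG V) (u : V) (P : MeasLabel) : Set V :=
  {v | v ∉ Γ.O ∧ v ≠ u ∧ Γ.lam v = P}

/-- `V_{k+1}^{≺,XY}` where `A = V_{∪k}^≺`. -/
def VXY (Γ : LOG V) (A : Set V) : Set V :=
  {u | u ∉ Γ.O ∧ Γ.lam u ∈ ({MeasLabel.XY, MeasLabel.X, MeasLabel.Y} : Set MeasLabel) ∧
    ∃ K, K ⊆ (A ∪ LamP Γ u MeasLabel.X ∪ LamP Γ u MeasLabel.Y) ∩ {v | v ∉ Γ.I} ∧
      (K ∩ LamP Γ u MeasLabel.Y) \ A = (odd Γ.G K ∩ LamP Γ u MeasLabel.Y) \ A ∧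
      odd Γ.G K \ (A ∪ LamP Γ u MeasLabel.Y ∪ LamP Γ u MeasLabel.Z) = {u}}

/-- `V_{k+1}^{≺,XZ}` where `A = V_{∪k}^≺`. -/
def VXZ (Γ : LOG V) (A : Set V) : Set V :=
  {u | u ∉ Γ.O ∧ Γ.lam u ∈ ({MeasLabel.XZ, MeasLabel.X, MeasLabel.Z} : Set MeasLabel) ∧
    ∃ K, K ⊆ (A ∪ LamP Γ u MeasLabel.X ∪ LamP Γ u MeasLabel.Y) ∩ {v | v ∉ Γ.I} ∧
      (K ∩ LamP Γ u MeasLabel.Y) \ A = (odd Γ.G (K ∪ {u}) ∩ LamP Γ u MeasLabel.Y) \ A ∧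
      odd Γ.G (K ∪ {u}) \ (A ∪ LamP Γ u MeasLabel.Y ∪ LamP Γ u MeasLabel.Z) = {u}}

/-- `V_{k+1}^{≺,YZ}` where `A = V_{∪k}^≺`. -/
def VYZ (Γ : LOG V) (A : Set V) : Set V :=
  {u | u ∉ Γ.O ∧ Γ.lam u ∈ ({MeasLabel.YZ, MeasLabel.Y, MeasLabel.Z} : Set MeasLabel) ∧
    ∃ K, K ⊆ (A ∪ LamP Γ u MeasLabel.X ∪ LamP Γ u MeasLabel.Y) ∩ {v | v ∉ Γ.I} ∧
      (K ∩ LamP Γ u MeasLabel.Y) \ A = (odd Γ.G (K ∪ {u}) ∩ LamP Γ u MeasLabel.Y) \ A ∧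
      odd Γ.G (K ∪ {u}) \ (A ∪ LamP Γ u MeasLabel.Y ∪ LamP Γ u MeasLabel.Z) = ∅}

end LOG


namespace LOG

theorem odd_ind {V : Type} [Fintype V] [DecidableEq V] (G : SimpleGraph V) (A : Set V) (w : V) :
    (open Classical in (if w ∈ odd G A then 1 else 0 : ZMod 2)) =
      ∑ x, (open Classical in (if G.Adj w x ∧ x ∈ A then 1 else 0 : ZMod 2)) := by
  classical
  have hc : ((G.neighborSet w ∩ A).ncard : ZMod 2) =
      ∑ x, (if G.Adj w x ∧ x ∈ A then 1 else 0 : ZMod 2) := by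
    rw [Finset.sum_boole, Set.ncard_eq_toFinset_card']
    congr 2
    ext x
    simp
  have hodd : w ∈ odd G A ↔ Odd ((G.neighborSet w ∩ A).ncard) := Iff.rfl
  by_cases ho : Odd ((G.neighborSet w ∩ A).ncard)
  · have e := (ZMod.natCast_eq_one_iff_odd).2 ho
    simp only [hodd, ho, if_true]
    rw [← e]
    convert hc
  · have e := (ZMod.natCast_eq_zero_iff_even).2 (Nat.not_odd_iff_even.1 ho)
    simp only [hodd, ho, if_false]
    rw [← e]
    convert hc

/-- Products of stabilizers commute, so local anticommutations come in pairs. -/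
theorem exists_other {V : Type} [Fintype V] (G : SimpleGraph V) (P Q : Set V) (v : V)
    (hv : ¬ ((v ∈ Q ∧ v ∈ odd G P) ↔ (v ∈ P ∧ v ∈ odd G Q))) :
    ∃ w, w ≠ v ∧ ¬ ((w ∈ Q ∧ w ∈ odd G P) ↔ (w ∈ P ∧ w ∈ odd G Q)) := by
  classical
  by_contra hno
  push Not at hno
  have key : ∀ A B : Set V, ∑ w, (if w ∈ A ∧ w ∈ odd G B then 1 else 0 : ZMod 2) =
      ∑ w, ∑ x, (if w ∈ A ∧ G.Adj w x ∧ x ∈ B then 1 else 0 : ZMod 2) := by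
    intro A B
    refine Finset.sum_congr rfl fun w _ => ?_
    by_cases hw : w ∈ A
    · have := odd_ind G B w
      simp only [hw, true_and]
      convert this
    · simp [hw]
  have hsym : ∑ w, (if w ∈ Q ∧ w ∈ odd G P then 1 else 0 : ZMod 2) =
      ∑ w, (if w ∈ P ∧ w ∈ odd G Q then 1 else 0 : ZMod 2) := by
    rw [key, key, Finset.sum_comm]
    refine Finset.sum_congr rfl fun w _ => Finset.sum_congr rfl fun x _ => ?_
    congr 1
    rw [G.adj_comm]
    apply propext
    tauto
  rw [← sub_eq_zero, ← Finset.sum_sub_distrib, Finset.sum_eq_single v] at hsym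
  · by_cases a : (v ∈ Q ∧ v ∈ odd G P) <;> by_cases b : (v ∈ P ∧ v ∈ odd G Q) <;>
      simp only [a, b, if_true, if_false] at hsym hv <;> first | exact hv trivial | skip
    all_goals first | (exact absurd hsym (by decide)) | (exact hv Iff.rfl)
  · intro w _ hw
    rw [sub_eq_zero]
    congr 1
    exact propext (hno w hw)
  · simp

/-- An input cannot be put into its own correction set, up to Pauli measurements, when a
Pauli flow exists. -/
theorem not_input {V : Type} [Fintype V] (Γ : LOG V)
    (p : V → Set V) (prec : V → V → Prop) (hf : IsPauliFlow Γ p prec) (u : V) (hO : u ∉ Γ.O)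
    (Q : Set V) (hu : u ∈ Q)
    (h1 : ∀ v ∈ Q, u ≠ v → Γ.labIn v {MeasLabel.X, MeasLabel.Y})
    (h2 : ∀ v ∈ odd Γ.G Q, u ≠ v → Γ.labIn v {MeasLabel.Y, MeasLabel.Z})
    (h3 : ∀ v, u ≠ v → Γ.labIn v {MeasLabel.Y} → (v ∈ Q ↔ v ∈ odd Γ.G Q)) :
    u ∉ Γ.I := by
  intro hI
  have hup : ∀ v, v ∉ Γ.O → u ∉ p v := fun v hv hp => hf.psub v hv u hp hI
  have hlu : Γ.lam u = MeasLabel.XY ∨ Γ.lam u = MeasLabel.X ∨ Γ.lam u = MeasLabel.Y := by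
    have a := hf.pf5 u hO
    have b := hf.pf6 u hO
    have c := hf.pf8 u hO
    have d := hup u hO
    cases e : Γ.lam u <;> simp_all
  have huo : u ∈ odd Γ.G (p u) := by
    rcases hlu with e | e | e
    · exact (hf.pf4 u hO e).2
    · exact hf.pf7 u hO e
    · have := hf.pf9 u hO e
      have := hup u hO
      tauto
  have hp1 := hf.pf1
  have hp2 := hf.pf2
  have hp3 := hf.pf3
  have hirr := hf.irrefl
  have htr := hf.trans
  simp only [labIn, Set.mem_insert_iff, Set.mem_singleton_iff] at h1 h2 h3 hp1 hp2 hp3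
  haveI : IsTrans V (flip prec) := ⟨fun a b c hab hbc => hf.trans c b a hbc hab⟩
  haveI : Std.Irrefl (flip prec) := ⟨fun a => hf.irrefl a⟩
  have wf : WellFounded (flip prec) := Finite.wellFounded_of_trans_of_irrefl _
  have main : ∀ v, (v = u ∨ prec u v) → (v ∈ Q ∨ v ∈ odd Γ.G Q) → False := by
    intro v
    induction v using wf.induction with
    | _ v ih =>
    intro huv hvQ
    have hvO : v ∉ Γ.O := by grind
    have hx : ¬ ((v ∈ Q ∧ v ∈ odd Γ.G (p v)) ↔ (v ∈ p v ∧ v ∈ odd Γ.G Q)) := by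
      by_cases e : v = u
      · subst e
        have := hup v hO
        tauto
      · have a := hf.pf7 v hvO
        have b := hf.pf8 v hvO
        have c := hf.pf9 v hvO
        grind
    obtain ⟨w, hwv, hw⟩ := exists_other Γ.G (p v) Q v hx
    by_cases e : w = u
    · subst e
      have hwp := hup v hvO
      have hpv : prec w v := by grind
      have hnp : ¬ prec v w := fun hh => hirr _ (htr _ _ _ hpv hh)
      have a := hp2 v hvO w
      have b := hp3 v hvO w hnp
      grind
    · have hvw : prec v w := by
        by_contra hnp
        have a := hp1 v hvO w
        have b := hp2 v hvO w
        have c := hp3 v hvO w hnp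
        have d := h1 w
        have f := h2 w
        have g := h3 w
        grind
      refine ih w hvw ?_ (by tauto)
      rcases huv with rfl | huv
      · exact Or.inr hvw
      · exact Or.inr (htr _ _ _ huv hvw)
  exact main u (Or.inl rfl) (Or.inl hu)

theorem Vcum_mono {V : Type} [Fintype V] (prec prec' : V → V → Prop)
    (hs : ∀ a b, prec' a b → prec a b) (k : ℕ) : Vcum prec k ⊆ Vcum prec' k := by
  induction k with
  | zero => exact fun v hv w hw => hv w (hs _ _ hw)
  | succ k ih =>
    intro v hv
    by_cases h1 : v ∈ Vcum prec' k
    · exact Or.inl h1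
    · rcases hv with hv | ⟨_, hv⟩
      · exact absurd (ih hv) h1
      · exact Or.inr ⟨h1, fun w hw hvw => hv w (fun hh => hw (ih hh)) (hs _ _ hvw)⟩

/-- Key step: if dropping all relations above `u` and changing `p u` still gives a flow,
then `u` is maximal. -/
theorem mem_V0_of_flow {V : Type} [Fintype V] (Γ : LOG V)
    (p : V → Set V) (prec : V → V → Prop) (h : IsMaxDelayed Γ p prec) (u : V) (q : V → Set V)
    (hq : IsPauliFlow Γ q (fun a b => prec a b ∧ a ≠ u)) : u ∈ Vlayer prec 0 := by
  by_contra hu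
  refine h.2 _ _ hq ⟨fun k => Set.ncard_le_ncard (Vcum_mono _ _ (fun a b hab => hab.1) k)
    (Set.toFinite _), 0, Set.ncard_lt_ncard ?_ (Set.toFinite _)⟩
  refine ⟨Vcum_mono _ _ (fun a b hab => hab.1) 0, fun hsub => hu ?_⟩
  exact hsub (show u ∈ Vcum _ 0 from fun w hw => hw.2 rfl)

theorem mem_V0_of_O {V : Type} [Fintype V] (Γ : LOG V)
    (p : V → Set V) (prec : V → V → Prop) (h : IsMaxDelayed Γ p prec) (u : V) (hu : u ∈ Γ.O) :
    u ∈ Vlayer prec 0 := by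
  have hf := h.1
  have hne : ∀ a, a ∉ Γ.O → a ≠ u := fun a ha e => ha (e ▸ hu)
  refine mem_V0_of_flow Γ p prec h u p
    { hf with
      irrefl := fun a ha => hf.irrefl a ha.1
      trans := fun a b c hab hbc => ⟨hf.trans a b c hab.1 hbc.1, hab.2⟩
      pf1 := fun a ha v hv hav hl => ⟨hf.pf1 a ha v hv hav hl, hne a ha⟩
      pf2 := fun a ha v hv hav hl => ⟨hf.pf2 a ha v hv hav hl, hne a ha⟩
      pf3 := fun a ha v hv hav hl => hf.pf3 a ha v (fun hp => hv ⟨hp, hne a ha⟩) hav hl }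

theorem mem_V0_of_set {V : Type} [Fintype V] (Γ : LOG V)
    (p : V → Set V) (prec : V → V → Prop) (h : IsMaxDelayed Γ p prec) (u : V)
    (Q : Set V) (hI : ∀ v ∈ Q, v ∉ Γ.I)
    (h1 : ∀ v ∈ Q, u ≠ v → Γ.labIn v {MeasLabel.X, MeasLabel.Y})
    (h2 : ∀ v ∈ odd Γ.G Q, u ≠ v → Γ.labIn v {MeasLabel.Y, MeasLabel.Z})
    (h3 : ∀ v, u ≠ v → Γ.labIn v {MeasLabel.Y} → (v ∈ Q ↔ v ∈ odd Γ.G Q))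
    (h4 : Γ.lam u = MeasLabel.XY → u ∉ Q ∧ u ∈ odd Γ.G Q)
    (h5 : Γ.lam u = MeasLabel.XZ → u ∈ Q ∧ u ∈ odd Γ.G Q)
    (h6 : Γ.lam u = MeasLabel.YZ → u ∈ Q ∧ u ∉ odd Γ.G Q)
    (h7 : Γ.lam u = MeasLabel.X → u ∈ odd Γ.G Q)
    (h8 : Γ.lam u = MeasLabel.Z → u ∈ Q)
    (h9 : Γ.lam u = MeasLabel.Y →
      ((u ∈ Q ∧ u ∉ odd Γ.G Q) ∨ (u ∉ Q ∧ u ∈ odd Γ.G Q))) :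
    u ∈ Vlayer prec 0 := by
  classical
  have hf := h.1
  have hs : Function.update p u Q u = Q := by simp
  have hn : ∀ a, a ≠ u → Function.update p u Q a = p a := fun a ha => by simp [ha]
  refine mem_V0_of_flow Γ p prec h u (Function.update p u Q) ?_
  constructor
  · exact fun a ha => hf.irrefl a ha.1
  · exact fun a b c hab hbc => ⟨hf.trans a b c hab.1 hbc.1, hab.2⟩
  all_goals
    intro a ha
    by_cases e : a = u
    · subst e
      rw [hs]
      first
        | assumption
        | exact fun v hv hav hl => absurd (h1 v hv hav) hl
        | exact fun v hv hav hl => absurd (h2 v hv hav) hl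
        | exact fun v _ hav hl => h3 v hav hl
    · rw [hn a e]
      first
        | exact hf.psub a ha
        | exact fun v hv hav hl => ⟨hf.pf1 a ha v hv hav hl, e⟩
        | exact fun v hv hav hl => ⟨hf.pf2 a ha v hv hav hl, e⟩
        | exact fun v hv hav hl => hf.pf3 a ha v (fun hp => hv ⟨hp, e⟩) hav hl
        | exact hf.pf4 a ha
        | exact hf.pf5 a ha
        | exact hf.pf6 a ha
        | exact hf.pf7 a ha
        | exact hf.pf8 a ha
        | exact hf.pf9 a ha

end LOG

open LOG in
/-- for a maximally delayed Pauli flow,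
`V_0^≺ = O ∪ V_0^{≺,XY} ∪ V_0^{≺,XZ} ∪ V_0^{≺,YZ}` (here `V_{∪(-1)}^≺ = ∅`). -/
theorem V0_of_maxDelayed {V : Type} [Fintype V] (Γ : LOG V)
    (p : V → Set V) (prec : V → V → Prop)
    (h : IsMaxDelayed Γ p prec) :
    Vlayer prec 0 = Γ.O ∪ VXY Γ ∅ ∪ VXZ Γ ∅ ∪ VYZ Γ ∅ := by
  have hf := h.1
  ext u
  constructor
  · intro hu
    have hu' : ∀ w, ¬ prec u w := hu
    by_cases hO : u ∈ Γ.O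
    · exact Or.inl (Or.inl (Or.inl hO))
    have h1 : ∀ v ∈ p u, u ≠ v → Γ.labIn v {MeasLabel.X, MeasLabel.Y} :=
      fun v hv hne => by_contra fun hl => hu' v (hf.pf1 u hO v hv hne hl)
    have h2 : ∀ v ∈ odd Γ.G (p u), u ≠ v → Γ.labIn v {MeasLabel.Y, MeasLabel.Z} :=
      fun v hv hne => by_contra fun hl => hu' v (hf.pf2 u hO v hv hne hl)
    have h3 := fun v => hf.pf3 u hO v (hu' v)
    have hI := hf.psub u hO
    simp only [labIn, Set.mem_insert_iff, Set.mem_singleton_iff] at h1 h2 h3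
    -- the three ways in which `u` can belong to a layer
    have cXY : Γ.lam u ∈ ({MeasLabel.XY, MeasLabel.X, MeasLabel.Y} : Set MeasLabel) →
        u ∉ p u → u ∈ odd Γ.G (p u) → u ∈ VXY Γ ∅ := by
      intro hl hnp hod
      refine ⟨hO, hl, p u, ?_, ?_, ?_⟩
      · intro v hv
        simp only [LamP, Set.mem_inter_iff, Set.mem_union, Set.mem_ofPred_eq]
        grind
      · ext v
        simp only [LamP, Set.mem_inter_iff, Set.mem_sdiff, Set.mem_ofPred_eq]
        grind
      · ext v
        simp only [LamP, Set.mem_union, Set.mem_sdiff, Set.mem_ofPred_eq, Set.mem_singleton_iff,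
          Set.mem_empty_iff_false]
        grind
    have hK : u ∈ p u → (p u \ {u}) ∪ {u} = p u := by
      intro hp
      ext v
      simp only [Set.mem_union, Set.mem_sdiff, Set.mem_singleton_iff]
      grind
    have cXZ : Γ.lam u ∈ ({MeasLabel.XZ, MeasLabel.X, MeasLabel.Z} : Set MeasLabel) →
        u ∈ p u → u ∈ odd Γ.G (p u) → u ∈ VXZ Γ ∅ := by
      intro hl hp hod
      refine ⟨hO, hl, p u \ {u}, ?_, ?_, ?_⟩
      · intro v hv
        simp only [LamP, Set.mem_inter_iff, Set.mem_union, Set.mem_ofPred_eq, Set.mem_sdiff,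
          Set.mem_singleton_iff] at hv ⊢
        grind
      · rw [hK hp]
        ext v
        simp only [LamP, Set.mem_inter_iff, Set.mem_sdiff, Set.mem_ofPred_eq,
          Set.mem_singleton_iff]
        grind
      · rw [hK hp]
        ext v
        simp only [LamP, Set.mem_union, Set.mem_sdiff, Set.mem_ofPred_eq, Set.mem_singleton_iff,
          Set.mem_empty_iff_false]
        grind
    have cYZ : Γ.lam u ∈ ({MeasLabel.YZ, MeasLabel.Y, MeasLabel.Z} : Set MeasLabel) →
        u ∈ p u → u ∉ odd Γ.G (p u) → u ∈ VYZ Γ ∅ := by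
      intro hl hp hod
      refine ⟨hO, hl, p u \ {u}, ?_, ?_, ?_⟩
      · intro v hv
        simp only [LamP, Set.mem_inter_iff, Set.mem_union, Set.mem_ofPred_eq, Set.mem_sdiff,
          Set.mem_singleton_iff] at hv ⊢
        grind
      · rw [hK hp]
        ext v
        simp only [LamP, Set.mem_inter_iff, Set.mem_sdiff, Set.mem_ofPred_eq,
          Set.mem_singleton_iff]
        grind
      · rw [hK hp]
        ext v
        simp only [LamP, Set.mem_union, Set.mem_sdiff, Set.mem_ofPred_eq,
          Set.mem_empty_iff_false]
        grind
    cases hl : Γ.lam u with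
    | XY =>
      have := hf.pf4 u hO hl
      exact Or.inl (Or.inl (Or.inr (cXY (by simp [hl]) this.1 this.2)))
    | XZ =>
      have := hf.pf5 u hO hl
      exact Or.inl (Or.inr (cXZ (by simp [hl]) this.1 this.2))
    | YZ =>
      have := hf.pf6 u hO hl
      exact Or.inr (cYZ (by simp [hl]) this.1 this.2)
    | X =>
      have := hf.pf7 u hO hl
      by_cases hp : u ∈ p u
      · exact Or.inl (Or.inr (cXZ (by simp [hl]) hp this))
      · exact Or.inl (Or.inl (Or.inr (cXY (by simp [hl]) hp this)))
    | Y =>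
      rcases hf.pf9 u hO hl with this | this
      · exact Or.inr (cYZ (by simp [hl]) this.1 this.2)
      · exact Or.inl (Or.inl (Or.inr (cXY (by simp [hl]) this.1 this.2)))
    | Z =>
      have := hf.pf8 u hO hl
      by_cases ho : u ∈ odd Γ.G (p u)
      · exact Or.inl (Or.inr (cXZ (by simp [hl]) this ho))
      · exact Or.inr (cYZ (by simp [hl]) this ho)
  · rintro (((hO | ⟨hO, hl, K, hK, hY, hod⟩) | ⟨hO, hl, K, hK, hY, hod⟩) |
      ⟨hO, hl, K, hK, hY, hod⟩)
    · exact mem_V0_of_O Γ p prec h u hO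
    · have hK' := fun v => @hK v
      have hY' := fun v => Set.ext_iff.1 hY v
      have hod' := fun v => Set.ext_iff.1 hod v
      simp only [LamP, Set.mem_inter_iff, Set.mem_union, Set.mem_sdiff, Set.mem_ofPred_eq,
        Set.mem_singleton_iff, Set.mem_empty_iff_false, Set.mem_insert_iff] at hK' hY' hod' hl
      have hu := hod' u
      apply mem_V0_of_set Γ p prec h u K <;>
        (try simp only [labIn, Set.mem_insert_iff, Set.mem_singleton_iff]) <;> grind
    · have hK' := fun v => @hK v
      have hY' := fun v => Set.ext_iff.1 hY v
      have hod' := fun v => Set.ext_iff.1 hod v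
      have hm : ∀ v, v ∈ K ∪ {u} ↔ v = u ∨ v ∈ K := fun v => by simp [or_comm]
      generalize K ∪ {u} = Q at hm hY' hod'
      simp only [LamP, Set.mem_inter_iff, Set.mem_union, Set.mem_sdiff, Set.mem_ofPred_eq,
        Set.mem_singleton_iff, Set.mem_empty_iff_false, Set.mem_insert_iff] at hK' hY' hod' hl
      have hu := hod' u
      have hI : u ∉ Γ.I := by
        apply not_input Γ p prec hf u hO Q <;>
          (try simp only [labIn, Set.mem_insert_iff, Set.mem_singleton_iff]) <;> grind
      apply mem_V0_of_set Γ p prec h u Q <;>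
        (try simp only [labIn, Set.mem_insert_iff, Set.mem_singleton_iff]) <;> grind
    · have hK' := fun v => @hK v
      have hY' := fun v => Set.ext_iff.1 hY v
      have hod' := fun v => Set.ext_iff.1 hod v
      have hm : ∀ v, v ∈ K ∪ {u} ↔ v = u ∨ v ∈ K := fun v => by simp [or_comm]
      generalize K ∪ {u} = Q at hm hY' hod'
      simp only [LamP, Set.mem_inter_iff, Set.mem_union, Set.mem_sdiff, Set.mem_ofPred_eq,
        Set.mem_singleton_iff, Set.mem_empty_iff_false, Set.mem_insert_iff] at hK' hY' hod' hl
      have hu := hod' u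
      have hI : u ∉ Γ.I := by
        apply not_input Γ p prec hf u hO Q <;>
          (try simp only [labIn, Set.mem_insert_iff, Set.mem_singleton_iff]) <;> grind
      apply mem_V0_of_set Γ p prec h u Q <;>
        (try simp only [labIn, Set.mem_insert_iff, Set.mem_singleton_iff]) <;> grind
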